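/- arXiv:2302.04319 — 5 statements merged into one kernel-verified Lean document; each statement's English description precedes it below -/
import Mathlib

section
/- For every constant c > 0, every ρ₀ with 0 < ρ₀ < 1, and all nonnegative reals ℓ₁, ℓ₂ with ℓ₁ + ℓ₂ ≤ d₂ where d₂ := −(2/c)·ln(1 − √(1 − ρ₀)), the combined detection probability satisfies 1 − (1 − e^{−c·ℓ₁})·(1 − e^{−c·ℓ₂}) ≥ ρ₀; that is, every point between two robots whose mutual distance is at most d₂ is detected with probability at least ρ₀. -/
/-- For `c > 0`, `0 < ρ₀ < 1` and nonnegative `ℓ₁, ℓ₂` with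
`ℓ₁ + ℓ₂ ≤ d₂ = -(2/c)·ln(1 - √(1 - ρ₀))`, the combined detection probability
`1 - (1 - e^{-c ℓ₁})·(1 - e^{-c ℓ₂})` is at least `ρ₀`: every point between
two robots at mutual distance at most `d₂` is detected with probability `≥ ρ₀`. -/
theorem stmt_5 (c ρ₀ ℓ₁ ℓ₂ : ℝ) (hc : 0 < c) (hρ₀ : 0 < ρ₀) (hρ₀' : ρ₀ < 1)
    (hℓ₁ : 0 ≤ ℓ₁) (hℓ₂ : 0 ≤ ℓ₂)
    (hsum : ℓ₁ + ℓ₂ ≤ -(2 / c) * Real.log (1 - Real.sqrt (1 - ρ₀))) :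
    1 - (1 - Real.exp (-(c * ℓ₁))) * (1 - Real.exp (-(c * ℓ₂))) ≥ ρ₀ := by
  set s := Real.sqrt (1 - ρ₀)
  have hsq : s ^ 2 = 1 - ρ₀ := Real.sq_sqrt (by linarith)
  have hs0 : 0 ≤ s := Real.sqrt_nonneg _
  have hs1 : s < 1 := by nlinarith
  have hlog : Real.log (1 - s) ≤ -(c * ℓ₁) / 2 + -(c * ℓ₂) / 2 := by
    have h := mul_le_mul_of_nonneg_left hsum hc.le
    have hcancel : c * (-(2 / c) * Real.log (1 - s)) = -2 * Real.log (1 - s) := by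
      field_simp
    linarith
  have hprod : 1 - s ≤ Real.exp (-(c * ℓ₁) / 2) * Real.exp (-(c * ℓ₂) / 2) := by
    rw [← Real.exp_add]
    exact (Real.log_le_iff_le_exp (by linarith)).mp hlog
  have hsquare (x : ℝ) : Real.exp x = Real.exp (x / 2) ^ 2 := by
    rw [← Real.exp_nat_mul]
    congr 1
    push_cast
    ring
  have hle_one (ℓ : ℝ) (hℓ : 0 ≤ ℓ) : Real.exp (-(c * ℓ) / 2) ≤ 1 :=
    Real.exp_le_one_iff.mpr (by linarith [mul_nonneg hc.le hℓ])
  have ha := hle_one ℓ₁ hℓ₁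
  have hb := hle_one ℓ₂ hℓ₂
  have hb0 := Real.exp_nonneg (-(c * ℓ₂) / 2)
  rw [hsquare (-(c * ℓ₁)), hsquare (-(c * ℓ₂))]
  set a := Real.exp (-(c * ℓ₁) / 2)
  set b := Real.exp (-(c * ℓ₂) / 2)
  have hab : a * b ≤ 1 := mul_le_one₀ ha hb0 hb
  have hbound : (1 - a * b) ^ 2 ≤ s ^ 2 :=
    pow_le_pow_left₀ (by linarith) (by linarith) 2
  nlinarith [sq_nonneg (a - b)]
end

section
/- Let ℓ > 0 and d₁, d₂ > 0 be reals, and set n := max(1, 1 + ⌈(ℓ − 2·d₁)/d₂⌉) (a positive integer, where ⌈·⌉ is the real ceiling). Then there exists a nondecreasing family of positions x : Fin n → ℝ with 0 ≤ x i ≤ ℓ for all i, such that x 0 ≤ d₁, ℓ − x (n−1) ≤ d₁, and x (i+1) − x i ≤ d₂ for every i < n − 1. -/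
/-- For `ℓ > 0` and `d₁, d₂ > 0`, with `n = max(1, 1 + ⌈(ℓ - 2 d₁)/d₂⌉)` robots
there exists a nondecreasing placement `x : Fin n → [0, ℓ]` whose first robot is
within `d₁` of `0`, whose last robot is within `d₁` of `ℓ`, and in which
consecutive robots are at distance at most `d₂`. -/
theorem stmt_6 (ℓ d₁ d₂ : ℝ) (hℓ : 0 < ℓ) (hd₁ : 0 < d₁) (hd₂ : 0 < d₂)
    (n : ℕ) (hn0 : 0 < n) (hn : (n : ℤ) = max 1 (1 + ⌈(ℓ - 2 * d₁) / d₂⌉)) :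
    ∃ x : Fin n → ℝ, Monotone x ∧ (∀ i, 0 ≤ x i ∧ x i ≤ ℓ) ∧
      x ⟨0, hn0⟩ ≤ d₁ ∧
      ℓ - x ⟨n - 1, Nat.sub_lt hn0 one_pos⟩ ≤ d₁ ∧
      ∀ i : ℕ, (h : i + 1 < n) →
        x ⟨i + 1, h⟩ - x ⟨i, Nat.lt_of_succ_lt h⟩ ≤ d₂ := by
  have key : ℓ - 2 * d₁ ≤ ((n - 1 : ℕ) : ℝ) * d₂ := by
    have hceil : ⌈(ℓ - 2 * d₁) / d₂⌉ ≤ ((n - 1 : ℕ) : ℤ) := by omega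
    rw [← div_le_iff₀ hd₂]
    exact_mod_cast Int.ceil_le.mp hceil
  refine ⟨fun i => min (d₁ + (i : ℕ) * d₂) ℓ, ?_, fun i => ⟨?_, min_le_right _ _⟩, ?_, ?_, ?_⟩
  · intro i j hij
    have hij' : (i : ℕ) ≤ (j : ℕ) := hij
    dsimp only
    gcongr
  · exact le_min (by positivity) hℓ.le
  · simp
  · dsimp only
    rw [sub_le_comm]
    exact le_min (by linarith) (by linarith)
  · intro i h
    dsimp only
    rw [sub_le_iff_le_add', ← sub_le_iff_le_add]
    refine le_min ?_ ?_
    · have := min_le_left (d₁ + ((i + 1 : ℕ) : ℝ) * d₂) ℓ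
      push_cast at this ⊢
      linarith
    · have := min_le_right (d₁ + ((i + 1 : ℕ) : ℝ) * d₂) ℓ
      linarith
end

section
/- Let ℓ > 0 and d₁, d₂ > 0 be reals, let m ≥ 1 be an integer, and let x : Fin m → ℝ be a nondecreasing family with 0 ≤ x i ≤ ℓ for all i, satisfying x 0 ≤ d₁, ℓ − x (m−1) ≤ d₁, and x (i+1) − x i ≤ d₂ for every i < m − 1. Then m ≥ max(1, 1 + ⌈(ℓ − 2·d₁)/d₂⌉), where ⌈·⌉ is the real ceiling. -/
/-- If consecutive terms of a finite family increase by at most `d`, then the `k`-th term exceeds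
the first by at most `k * d`. -/
theorem Fin.le_add_mul_of_sub_le {m : ℕ} {x : Fin m → ℝ} {d : ℝ} (hm : 0 < m)
    (hgap : ∀ i : ℕ, (h : i + 1 < m) → x ⟨i + 1, h⟩ - x ⟨i, Nat.lt_of_succ_lt h⟩ ≤ d)
    (k : ℕ) (hk : k < m) : x ⟨k, hk⟩ ≤ x ⟨0, hm⟩ + k * d := by
  induction k with
  | zero => simp
  | succ k ih =>
    have h₁ := ih (Nat.lt_of_succ_lt hk)
    have h₂ := hgap k hk
    push_cast
    linarith

/-- For `ℓ > 0` and `d₁, d₂ > 0`, any nondecreasing placement of `m ≥ 1` robots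
`x : Fin m → [0, ℓ]` with first robot within `d₁` of `0`, last robot within `d₁`
of `ℓ`, and consecutive robots at distance at most `d₂`, must satisfy
`m ≥ max(1, 1 + ⌈(ℓ - 2 d₁)/d₂⌉)`. -/
theorem stmt_7 (ℓ d₁ d₂ : ℝ) (hℓ : 0 < ℓ) (hd₁ : 0 < d₁) (hd₂ : 0 < d₂)
    (m : ℕ) (hm : 0 < m) (x : Fin m → ℝ) (hmono : Monotone x)
    (hbounds : ∀ i, 0 ≤ x i ∧ x i ≤ ℓ)
    (hfirst : x ⟨0, hm⟩ ≤ d₁)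
    (hlast : ℓ - x ⟨m - 1, Nat.sub_lt hm one_pos⟩ ≤ d₁)
    (hgap : ∀ i : ℕ, (h : i + 1 < m) →
      x ⟨i + 1, h⟩ - x ⟨i, Nat.lt_of_succ_lt h⟩ ≤ d₂) :
    (m : ℤ) ≥ max 1 (1 + ⌈(ℓ - 2 * d₁) / d₂⌉) := by
  have hx := Fin.le_add_mul_of_sub_le hm hgap (m - 1) (Nat.sub_lt hm one_pos)
  rw [Nat.cast_pred hm] at hx
  have hceil : ⌈(ℓ - 2 * d₁) / d₂⌉ ≤ (m : ℤ) - 1 := by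
    rw [Int.ceil_le, div_le_iff₀ hd₂]
    push_cast
    linarith
  exact max_le (by exact_mod_cast hm) (by linarith)
end

section
/- Let c > 0, 0 < ρ₀ < 1, ℓ > 0, and set d₁ := −ln(ρ₀)/c, d₂ := −(2/c)·ln(1 − √(1 − ρ₀)), and n := max(1, 1 + ⌈(ℓ − 2·d₁)/d₂⌉). Then there exists a nondecreasing placement x : Fin n → [0, ℓ] such that for every p ∈ [0, ℓ] the coverage probability at p under x is at least ρ₀; that is, n = ζ(ℓ) robots suffice to guard a segment of length ℓ with detection probability at least ρ₀ everywhere. -/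
/-- Under the exponential decay sensing model `ρ(r) = e^{-c r}`, with robots at
nondecreasing positions `x : Fin n → ℝ` (with `n > 0`), the coverage
probability at a point `p` is at least `ρ₀` in every applicable case:
`e^{-c (x₀ - p)}` if `p ≤ x₀`, `e^{-c (p - x_{n-1})}` if `p ≥ x_{n-1}`, and
`e^{-c (p - xᵢ)} + e^{-c (x_{i+1} - p)} - e^{-c (p - xᵢ)} e^{-c (x_{i+1} - p)}`
if `xᵢ ≤ p ≤ x_{i+1}`. -/
def CoveredAt (c ρ₀ : ℝ) {n : ℕ} (hn : 0 < n) (x : Fin n → ℝ) (p : ℝ) : Prop :=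
  (p ≤ x ⟨0, hn⟩ → ρ₀ ≤ Real.exp (-(c * (x ⟨0, hn⟩ - p)))) ∧
  (x ⟨n - 1, Nat.sub_lt hn one_pos⟩ ≤ p →
    ρ₀ ≤ Real.exp (-(c * (p - x ⟨n - 1, Nat.sub_lt hn one_pos⟩)))) ∧
  (∀ i : ℕ, (h : i + 1 < n) →
    x ⟨i, Nat.lt_of_succ_lt h⟩ ≤ p → p ≤ x ⟨i + 1, h⟩ →
    ρ₀ ≤ Real.exp (-(c * (p - x ⟨i, Nat.lt_of_succ_lt h⟩)))
          + Real.exp (-(c * (x ⟨i + 1, h⟩ - p)))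
          - Real.exp (-(c * (p - x ⟨i, Nat.lt_of_succ_lt h⟩)))
            * Real.exp (-(c * (x ⟨i + 1, h⟩ - p))))

/-- A single robot within distance `-ln ρ₀ / c` detects with probability at least `ρ₀`. -/
theorem le_exp_neg_mul_of_le_neg_log_div {c ρ₀ r : ℝ} (hc : 0 < c) (hρ₀ : 0 < ρ₀)
    (hr : r ≤ -Real.log ρ₀ / c) : ρ₀ ≤ Real.exp (-(c * r)) := by
  rw [le_div_iff₀ hc] at hr
  rw [← Real.log_le_iff_le_exp hρ₀]
  linarith

theorem one_sub_sqrt_one_sub_mem_Ioo {ρ₀ : ℝ} (hρ₀ : 0 < ρ₀) (hρ₀' : ρ₀ < 1) :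
    1 - Real.sqrt (1 - ρ₀) ∈ Set.Ioo (0 : ℝ) 1 := by
  have h₀ : 0 < Real.sqrt (1 - ρ₀) := Real.sqrt_pos.2 (by linarith)
  have h₁ : Real.sqrt (1 - ρ₀) < 1 := by
    rw [Real.sqrt_lt' one_pos]
    linarith
  constructor <;> linarith

/-- Two robots at distances `s` and `t` from a point between them, with total separation
at most `-(2/c) ln (1 - √(1 - ρ₀))`, jointly detect with probability at least `ρ₀`. -/
theorem le_exp_add_exp_sub_mul {c ρ₀ s t : ℝ} (hc : 0 < c) (hρ₀ : 0 < ρ₀) (hρ₀' : ρ₀ < 1)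
    (hst₀ : 0 ≤ s + t)
    (hst : s + t ≤ -(2 / c) * Real.log (1 - Real.sqrt (1 - ρ₀))) :
    ρ₀ ≤ Real.exp (-(c * s)) + Real.exp (-(c * t))
      - Real.exp (-(c * s)) * Real.exp (-(c * t)) := by
  have hlog : Real.log (1 - Real.sqrt (1 - ρ₀)) ≤ -(c * s) / 2 + -(c * t) / 2 := by
    have h := mul_le_mul_of_nonneg_left hst hc.le
    have h' : c * (-(2 / c) * Real.log (1 - Real.sqrt (1 - ρ₀)))
        = -2 * Real.log (1 - Real.sqrt (1 - ρ₀)) := by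
      field_simp
    linarith
  rw [Real.log_le_iff_le_exp (one_sub_sqrt_one_sub_mem_Ioo hρ₀ hρ₀').1, Real.exp_add] at hlog
  have hsq (u : ℝ) : Real.exp u = Real.exp (u / 2) ^ 2 := by
    rw [← Real.exp_nat_mul]
    congr 1
    push_cast
    ring
  rw [hsq (-(c * s)), hsq (-(c * t))]
  have hle' := Real.exp_le_one_iff.2 (by nlinarith : -(c * s) / 2 + -(c * t) / 2 ≤ 0)
  rw [Real.exp_add] at hle'
  set a := Real.exp (-(c * s) / 2)
  set b := Real.exp (-(c * t) / 2)
  have hr : (1 - a * b) ^ 2 ≤ Real.sqrt (1 - ρ₀) ^ 2 :=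
    pow_le_pow_left₀ (by linarith) (by linarith) 2
  rw [Real.sq_sqrt (by linarith)] at hr
  nlinarith [sq_nonneg (a - b)]

/-- For `c > 0`, `0 < ρ₀ < 1`, `ℓ > 0`, with `d₁ = -ln ρ₀ / c`,
`d₂ = -(2/c)·ln(1 - √(1 - ρ₀))` and `n = max(1, 1 + ⌈(ℓ - 2 d₁)/d₂⌉)`, there is
a nondecreasing placement of `n` robots on `[0, ℓ]` achieving coverage
probability at least `ρ₀` at every point of `[0, ℓ]`. -/
theorem stmt_8 (c ρ₀ ℓ : ℝ) (hc : 0 < c) (hρ₀ : 0 < ρ₀) (hρ₀' : ρ₀ < 1)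
    (hℓ : 0 < ℓ) (n : ℕ) (hn0 : 0 < n)
    (hn : (n : ℤ) = max 1 (1 +
      ⌈(ℓ - 2 * (-Real.log ρ₀ / c)) /
        (-(2 / c) * Real.log (1 - Real.sqrt (1 - ρ₀)))⌉)) :
    ∃ x : Fin n → ℝ, Monotone x ∧ (∀ i, 0 ≤ x i ∧ x i ≤ ℓ) ∧
      ∀ p ∈ Set.Icc (0 : ℝ) ℓ, CoveredAt c ρ₀ hn0 x p := by
  set d₁ := -Real.log ρ₀ / c
  set d₂ := -(2 / c) * Real.log (1 - Real.sqrt (1 - ρ₀))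
  have hd₁_pos : 0 < d₁ := div_pos (neg_pos.2 (Real.log_neg hρ₀ hρ₀')) hc
  have hd₂_pos : 0 < d₂ := by
    have h := one_sub_sqrt_one_sub_mem_Ioo hρ₀ hρ₀'
    exact mul_pos_of_neg_of_neg (neg_neg_of_pos (by positivity)) (Real.log_neg h.1 h.2)
  have hn_one : (1 : ℝ) ≤ n := by exact_mod_cast hn0
  have hgap : ℓ - 2 * d₁ ≤ (n - 1) * d₂ := by
    rw [← div_le_iff₀ hd₂_pos]
    have h : ⌈(ℓ - 2 * d₁) / d₂⌉ ≤ (n : ℤ) - 1 := by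
      have := le_max_right (1 : ℤ) (1 + ⌈(ℓ - 2 * d₁) / d₂⌉)
      omega
    exact_mod_cast Int.ceil_le.1 h
  -- Margin at both ends, capped so that a single robot sits at the midpoint.
  obtain ⟨e, he₀, heℓ, hed₁, hed₂⟩ :
      ∃ e : ℝ, 0 ≤ e ∧ 2 * e ≤ ℓ ∧ e ≤ d₁ ∧ ℓ - 2 * e ≤ (n - 1) * d₂ := by
    have hnd : 0 ≤ (n - 1) * d₂ := mul_nonneg (by linarith) hd₂_pos.le
    rcases le_total d₁ (ℓ / 2) with h | h
    · exact ⟨d₁, hd₁_pos.le, by linarith, le_rfl, hgap⟩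
    · exact ⟨ℓ / 2, by linarith, by linarith, h, by linarith⟩
  obtain ⟨g, hg₀, hgd₂, hg⟩ : ∃ g : ℝ, 0 ≤ g ∧ g ≤ d₂ ∧ (n - 1) * g = ℓ - 2 * e := by
    rcases hn_one.eq_or_lt with h | h
    · refine ⟨0, le_rfl, hd₂_pos.le, ?_⟩
      rw [← h] at hed₂ ⊢
      linarith
    · have h' : (0 : ℝ) < n - 1 := by linarith
      refine ⟨(ℓ - 2 * e) / (n - 1), div_nonneg (by linarith) h'.le, ?_, by field_simp⟩
      rw [div_le_iff₀ h']
      linarith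
  refine ⟨fun i => e + (i : ℕ) * g, fun i j hij => ?_, fun i => ⟨by positivity, ?_⟩,
    fun p hp => ⟨fun _ => ?_, fun _ => ?_, fun i hi _ _ => ?_⟩⟩
  · have : ((i : ℕ) : ℝ) ≤ (j : ℕ) := by exact_mod_cast hij
    dsimp only
    gcongr
  · have h : ((i : ℕ) : ℝ) ≤ n - 1 := by
      have : ((i : ℕ) : ℝ) + 1 ≤ n := by exact_mod_cast i.2
      linarith
    have := mul_le_mul_of_nonneg_right h hg₀
    linarith
  · refine le_exp_neg_mul_of_le_neg_log_div hc hρ₀ ?_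
    simp only [Nat.cast_zero, zero_mul]
    linarith [hp.1]
  · refine le_exp_neg_mul_of_le_neg_log_div hc hρ₀ ?_
    simp only [Nat.cast_pred hn0]
    linarith [hp.2]
  · refine le_exp_add_exp_sub_mul hc hρ₀ hρ₀' ?_ ?_ <;> simp only [Nat.cast_add, Nat.cast_one] <;> linarith
end

section
/- Let c > 0, 0 < ρ₀ < 1, ℓ > 0, and set d₁ := −ln(ρ₀)/c and d₂ := −(2/c)·ln(1 − √(1 − ρ₀)). If m ≥ 1 and x : Fin m → [0, ℓ] is a nondecreasing placement such that the coverage probability at every point p ∈ [0, ℓ] under x is at least ρ₀, then x 0 ≤ d₁, ℓ − x (m−1) ≤ d₁, and x (i+1) − x i ≤ d₂ for every i < m − 1. -/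
/-- For `c > 0`, `0 < ρ₀ < 1`, `ℓ > 0`, `d₁ = -ln ρ₀ / c` and
`d₂ = -(2/c)·ln(1 - √(1 - ρ₀))`: any nondecreasing placement of `m ≥ 1` robots
on `[0, ℓ]` achieving coverage probability at least `ρ₀` everywhere on `[0, ℓ]`
must have its first robot within `d₁` of `0`, its last robot within `d₁` of
`ℓ`, and consecutive robots at distance at most `d₂`. -/
theorem stmt_9 (c ρ₀ ℓ : ℝ) (hc : 0 < c) (hρ₀ : 0 < ρ₀) (hρ₀' : ρ₀ < 1)
    (hℓ : 0 < ℓ) (m : ℕ) (hm : 0 < m) (x : Fin m → ℝ) (hmono : Monotone x)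
    (hbounds : ∀ i, 0 ≤ x i ∧ x i ≤ ℓ)
    (hcov : ∀ p ∈ Set.Icc (0 : ℝ) ℓ, CoveredAt c ρ₀ hm x p) :
    x ⟨0, hm⟩ ≤ -Real.log ρ₀ / c ∧
    ℓ - x ⟨m - 1, Nat.sub_lt hm one_pos⟩ ≤ -Real.log ρ₀ / c ∧
    ∀ i : ℕ, (h : i + 1 < m) →
      x ⟨i + 1, h⟩ - x ⟨i, Nat.lt_of_succ_lt h⟩ ≤
        -(2 / c) * Real.log (1 - Real.sqrt (1 - ρ₀)) := by
  have le_neg_log_div : ∀ d : ℝ, ρ₀ ≤ Real.exp (-(c * d)) → d ≤ -Real.log ρ₀ / c := by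
    intro d h
    have := (Real.log_le_iff_le_exp hρ₀).2 h
    rw [le_div_iff₀ hc]
    linarith
  refine ⟨?_, ?_, ?_⟩
  · have h := (hcov 0 ⟨le_rfl, hℓ.le⟩).1 (hbounds _).1
    rw [sub_zero] at h
    exact le_neg_log_div _ h
  · exact le_neg_log_div _ ((hcov ℓ ⟨hℓ.le, le_rfl⟩).2.1 (hbounds _).2)
  · intro i hi
    have hle : x ⟨i, Nat.lt_of_succ_lt hi⟩ ≤ x ⟨i + 1, hi⟩ :=
      hmono (Fin.mk_le_mk.2 (Nat.le_succ i))
    have hcov_i := fun p hp => (hcov p hp).2.2 i hi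
    have ha := (hbounds ⟨i, Nat.lt_of_succ_lt hi⟩).1
    have hb := (hbounds ⟨i + 1, hi⟩).2
    generalize x ⟨i, Nat.lt_of_succ_lt hi⟩ = a at *
    generalize x ⟨i + 1, hi⟩ = b at *
    have h := hcov_i ((a + b) / 2) ⟨by linarith, by linarith⟩ (by linarith) (by linarith)
    have hl : (a + b) / 2 - a = (b - a) / 2 := by ring
    have hr : b - (a + b) / 2 = (b - a) / 2 := by ring
    rw [hl, hr] at h
    have hsqrt : 1 - Real.exp (-(c * ((b - a) / 2))) ≤ Real.sqrt (1 - ρ₀) :=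
      Real.le_sqrt_of_sq_le (by linarith)
    have hlt : Real.sqrt (1 - ρ₀) < 1 := by
      rw [Real.sqrt_lt' one_pos]
      linarith
    have hlog := (Real.log_le_iff_le_exp (sub_pos.2 hlt)).2 (sub_le_comm.1 hsqrt)
    have heq : -(2 / c) * Real.log (1 - Real.sqrt (1 - ρ₀)) =
        -(2 * Real.log (1 - Real.sqrt (1 - ρ₀))) / c := by ring
    rw [heq, le_div_iff₀ hc]
    linarith
end
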